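/- Let Σ_Λ = {Σ_λ = (γ_λ,f_λ,g_λ)}_{λ∈Λ} and h⁰, h ∈ H satisfy Assumption 1 with φ_λ(t,r) = p_λ(t)·r, where each p_λ : [0,∞) → R is Lebesgue measurable and locally integrable, and with α_λ(t,r) = d·r for a constant d ≥ 0. Suppose there exist κ > 0 and c ∈ R such that for all λ ∈ Λ every solution of the linear equation ẇ = −p_λ(t)w satisfies |w(t)| ≤ κ e^{−c(t−t_0)} |w(t_0)| for all t ≥ t_0 ≥ 0. If there exist η, μ > 0 such that for every γ ∈ Γ_Λ = {γ_λ : λ ∈ Λ}, n^γ_{(t_0,t]} ln(d) − (c−η)(t−t_0) ≤ μ for all t ≥ t_0 ≥ 0 (with the conventions 0·ln(0) = 0 and r·ln(0) = −∞ for r > 0), then Σ_Λ is weakly (h⁰,h)-ISS. -/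

import Mathlib

open MeasureTheory Filter Set
open scoped Classical

noncomputable section

/-- State/input spaces: `ℝ^k` with the Euclidean norm. -/
abbrev Stt (k : ℕ) : Type := EuclideanSpace ℝ (Fin k)

/-- An impulse-time sequence, identified with its (locally finite) set of impulse
times, a subset of `(0,∞)` with finitely many points below any bound. -/
def IsImpulseSeq (γ : Set ℝ) : Prop :=
  γ ⊆ Set.Ioi (0 : ℝ) ∧ ∀ T : ℝ, (γ ∩ Set.Iic T).Finite

/-- `n^γ_{(s,t]}`: the number of impulse times in the interval `(s,t]`. -/
def nJumps (γ : Set ℝ) (s t : ℝ) : ℕ := (γ ∩ Set.Ioc s t).ncard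

/-- Uniform incremental boundedness of a set of impulse-time sequences. -/
def UIB (S : Set (Set ℝ)) : Prop :=
  ∃ φ : ℝ → ℝ, ContinuousOn φ (Set.Ici 0) ∧ MonotoneOn φ (Set.Ici 0) ∧
    (∀ s : ℝ, 0 ≤ s → 0 ≤ φ s) ∧
    ∀ γ ∈ S, ∀ t0 t : ℝ, 0 ≤ t0 → t0 < t → (nJumps γ t0 t : ℝ) ≤ φ (t - t0)

/-- Class `K∞` functions `[0,∞) → [0,∞)`. -/
def ClassKInf (α : ℝ → ℝ) : Prop :=
  ContinuousOn α (Set.Ici 0) ∧ StrictMonoOn α (Set.Ici 0) ∧ α 0 = 0 ∧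
    ∀ M : ℝ, ∃ r : ℝ, 0 ≤ r ∧ M ≤ α r

/-- Class `KL` functions. -/
def ClassKL (β : ℝ → ℝ → ℝ) : Prop :=
  (∀ t : ℝ, 0 ≤ t → ClassKInf fun r => β r t) ∧
  ∀ r : ℝ, 0 ≤ r → AntitoneOn (fun t => β r t) (Set.Ici 0) ∧
    Filter.Tendsto (fun t => β r t) Filter.atTop (nhds 0)

/-- Positive definite functions `[0,∞) → [0,∞)`. -/
def PosDef (ρ : ℝ → ℝ) : Prop :=
  ContinuousOn ρ (Set.Ici 0) ∧ ρ 0 = 0 ∧ ∀ r : ℝ, 0 < r → 0 < ρ r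

/-- Locally integrable (on compacts) function `[0,∞) → ℝ` (extended to `ℝ`). -/
def LocIntegrable (p : ℝ → ℝ) : Prop :=
  ∀ a b : ℝ, MeasureTheory.IntegrableOn p (Set.Icc a b)

/-- Inputs: measurable, locally essentially bounded functions. -/
def IsInput {m : ℕ} (u : ℝ → Stt m) : Prop :=
  Measurable u ∧ ∀ T : ℝ, ∃ C : ℝ, ∀ᵐ t ∂MeasureTheory.volume, t ∈ Set.Icc 0 T → ‖u t‖ ≤ C

/-- `‖u_I‖_γ`: max of the essential supremum of `‖u‖` over `I` and the supremum of
`‖u‖` over `γ ∩ I`. -/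
def inputNorm {m : ℕ} (γ : Set ℝ) (u : ℝ → Stt m) (I : Set ℝ) : ℝ :=
  max (essSup (fun t => ‖u t‖) (MeasureTheory.volume.restrict I))
      (sSup ((fun t => ‖u t‖) '' (γ ∩ I)))

/-- Solution of the impulsive system `(γ,f,g)` on `[t0,T)` with initial state `x0`
and input `u` (Carathéodory solutions, in integral form, between impulses). -/
structure IsSolution {n m : ℕ} (γ : Set ℝ) (f g : ℝ → Stt n → Stt m → Stt n)
    (t0 : ℝ) (x0 : Stt n) (u : ℝ → Stt m) (T : EReal) (x : ℝ → Stt n) : Prop where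
  lt : (t0 : EReal) < T
  init : x t0 = x0
  flow : ∀ t1 t2 : ℝ, t0 ≤ t1 → t1 ≤ t2 → (t2 : EReal) < T → Set.Ioc t1 t2 ∩ γ = ∅ →
    MeasureTheory.IntegrableOn (fun s => f s (x s) (u s)) (Set.Icc t1 t2) ∧
    x t2 = x t1 + ∫ s in t1..t2, f s (x s) (u s)
  jump : ∀ t ∈ γ, t0 < t → (t : EReal) < T →
    ∃ L : Stt n, Filter.Tendsto x (nhdsWithin t (Set.Iio t)) (nhds L) ∧
      x t = L + g t L (u t)

/-- Maximally defined solution. -/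
def IsMaxSolution {n m : ℕ} (γ : Set ℝ) (f g : ℝ → Stt n → Stt m → Stt n)
    (t0 : ℝ) (x0 : Stt n) (u : ℝ → Stt m) (T : EReal) (x : ℝ → Stt n) : Prop :=
  IsSolution γ f g t0 x0 u T x ∧
    ∀ (T' : EReal) (x' : ℝ → Stt n), IsSolution γ f g t0 x0 u T' x' →
      (∀ t : ℝ, t0 ≤ t → (t : EReal) < T → x' t = x t) → T' ≤ T

/-- Weak `(h⁰,h)`-ISS of a parametrized family of impulsive systems. -/
def WeaklyISS {n m : ℕ} {Λ : Type*} (γ : Λ → Set ℝ)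
    (f g : Λ → ℝ → Stt n → Stt m → Stt n) (h0 h : ℝ → Stt n → ℝ) : Prop :=
  ∃ β : ℝ → ℝ → ℝ, ∃ ρ : ℝ → ℝ, ClassKL β ∧ ClassKInf ρ ∧
    ∀ (l : Λ) (t0 : ℝ) (x0 : Stt n) (u : ℝ → Stt m) (T : EReal) (x : ℝ → Stt n),
      0 ≤ t0 → IsInput u → IsMaxSolution (γ l) (f l) (g l) t0 x0 u T x →
      ∀ t : ℝ, t0 ≤ t → (t : EReal) < T →
        h t (x t) ≤ β (h0 t0 x0) (t - t0) + ρ (inputNorm (γ l) u (Set.Ioc t0 t))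

/-- Strong `(h⁰,h)`-ISS of a parametrized family of impulsive systems. -/
def StronglyISS {n m : ℕ} {Λ : Type*} (γ : Λ → Set ℝ)
    (f g : Λ → ℝ → Stt n → Stt m → Stt n) (h0 h : ℝ → Stt n → ℝ) : Prop :=
  ∃ β : ℝ → ℝ → ℝ, ∃ ρ : ℝ → ℝ, ClassKL β ∧ ClassKInf ρ ∧
    ∀ (l : Λ) (t0 : ℝ) (x0 : Stt n) (u : ℝ → Stt m) (T : EReal) (x : ℝ → Stt n),
      0 ≤ t0 → IsInput u → IsMaxSolution (γ l) (f l) (g l) t0 x0 u T x →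
      ∀ t : ℝ, t0 ≤ t → (t : EReal) < T →
        h t (x t) ≤ β (h0 t0 x0) (t - t0 + (nJumps (γ l) t0 t : ℝ)) +
          ρ (inputNorm (γ l) u (Set.Ioc t0 t))

/-- Locally Lipschitz on a set. -/
def LocLipschitzOn {α β : Type*} [PseudoEMetricSpace α] [PseudoEMetricSpace β]
    (s : Set α) (f : α → β) : Prop :=
  ∀ x ∈ s, ∃ K : NNReal, ∃ t ∈ nhdsWithin x s, LipschitzOnWith K f t

/-- `V ∈ V(γ)` with `Vm` its left-limit function at impulse times: `V` is locally
Lipschitz on each inter-impulse strip and has the joint left limit `Vm τ ξ`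
at each `τ ∈ γ`. -/
def InClassV {n : ℕ} (γ : Set ℝ) (V Vm : ℝ → Stt n → ℝ) : Prop :=
  (∀ a b : ℝ, 0 ≤ a → Set.Ioo a b ∩ γ = ∅ →
    LocLipschitzOn (Set.Ico a b ×ˢ (Set.univ : Set (Stt n)))
      (fun q : ℝ × Stt n => V q.1 q.2)) ∧
  ∀ τ ∈ γ, ∀ ξ : Stt n,
    Filter.Tendsto (fun q : ℝ × Stt n => V q.1 q.2)
      (nhdsWithin (τ, ξ) (Set.Iio τ ×ˢ (Set.univ : Set (Stt n)))) (nhds (Vm τ ξ))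

/-- Upper-right Dini derivative of `V` along the flow map `f`. -/
def DiniAlong {n m : ℕ} (f : ℝ → Stt n → Stt m → Stt n) (V : ℝ → Stt n → ℝ)
    (t : ℝ) (ξ : Stt n) (μ : Stt m) : ℝ :=
  Filter.limsup (fun d : ℝ => (V (t + d) (ξ + d • f t ξ μ) - V t ξ) / d)
    (nhdsWithin 0 (Set.Ioi 0))

/-- Carathéodory function `[0,∞) × [0,∞) → ℝ`. -/
def Caratheodory2 (φ : ℝ → ℝ → ℝ) : Prop :=
  (∀ r : ℝ, Measurable fun t => φ t r) ∧
  (∀ t : ℝ, ContinuousOn (φ t) (Set.Ici 0)) ∧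
  ∀ a b c : ℝ, ∃ mK : ℝ → ℝ, MeasureTheory.IntegrableOn mK (Set.Icc a b) ∧
    ∀ t ∈ Set.Icc a b, ∀ r ∈ Set.Icc (0 : ℝ) c, |φ t r| ≤ mK t

/-- Assumption 1 of the paper, with all the data explicit. -/
def Assumption1 {n m : ℕ} {Λ : Type*} (γ : Λ → Set ℝ)
    (f g : Λ → ℝ → Stt n → Stt m → Stt n) (h0 h : ℝ → Stt n → ℝ)
    (V Vm : Λ → ℝ → Stt n → ℝ) (φ1 φ2 χ π : ℝ → ℝ)
    (vφ al : Λ → ℝ → ℝ → ℝ) : Prop :=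
  ClassKInf φ1 ∧ ClassKInf φ2 ∧ ClassKInf χ ∧ ClassKInf π ∧
  (∀ l : Λ, InClassV (γ l) (V l) (Vm l)) ∧
  (∀ l : Λ, Caratheodory2 (vφ l)) ∧
  (∀ (l : Λ) (t r : ℝ), 0 ≤ t → 0 ≤ r → 0 ≤ al l t r) ∧
  (∀ (l : Λ) (t : ℝ) (ξ : Stt n), 0 ≤ t →
    φ1 (h t ξ) ≤ V l t ξ ∧ V l t ξ ≤ φ2 (h0 t ξ)) ∧
  (∀ (l : Λ) (t : ℝ) (ξ : Stt n) (μ : Stt m), 0 ≤ t → t ∉ γ l → χ ‖μ‖ ≤ V l t ξ →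
    DiniAlong (f l) (V l) t ξ μ ≤ - vφ l t (V l t ξ)) ∧
  (∀ (l : Λ) (t : ℝ) (ξ : Stt n) (μ : Stt m), t ∈ γ l → χ ‖μ‖ ≤ Vm l t ξ →
    V l t (ξ + g l t ξ μ) ≤ al l t (Vm l t ξ)) ∧
  (∀ (l : Λ) (t : ℝ) (ξ : Stt n) (μ : Stt m), t ∈ γ l → Vm l t ξ ≤ χ ‖μ‖ →
    V l t (ξ + g l t ξ μ) ≤ π ‖μ‖)

/-- Solution of the scalar comparison differential/difference inclusion. -/
structure IsCompSol (γ : Set ℝ) (vφ al : ℝ → ℝ → ℝ) (t0 z0 : ℝ) (T : EReal)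
    (z : ℝ → ℝ) : Prop where
  lt : (t0 : EReal) < T
  init : z t0 = z0
  nonneg : ∀ t : ℝ, t0 ≤ t → (t : EReal) < T → 0 ≤ z t
  flow : ∀ t1 t2 : ℝ, t0 ≤ t1 → t1 ≤ t2 → (t2 : EReal) < T → Set.Ioc t1 t2 ∩ γ = ∅ →
    ∃ d : ℝ → ℝ, MeasureTheory.IntegrableOn d (Set.Icc t1 t2) ∧
      (∀ᵐ s ∂MeasureTheory.volume, s ∈ Set.Icc t1 t2 → d s ≤ - vφ s (z s)) ∧
      ∀ t ∈ Set.Icc t1 t2, z t = z t1 + ∫ s in t1..t, d s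
  jump : ∀ t ∈ γ, t0 < t → (t : EReal) < T →
    ∃ L : ℝ, Filter.Tendsto z (nhdsWithin t (Set.Iio t)) (nhds L) ∧ z t ≤ al t L

/-- The family of comparison systems is weakly GUAS. -/
def CompWeakGUAS {Λ : Type*} (γ : Λ → Set ℝ) (vφ al : Λ → ℝ → ℝ → ℝ) : Prop :=
  ∃ β : ℝ → ℝ → ℝ, ClassKL β ∧
    ∀ (l : Λ) (t0 z0 : ℝ) (T : EReal) (z : ℝ → ℝ), 0 ≤ t0 → 0 ≤ z0 →
      IsCompSol (γ l) (vφ l) (al l) t0 z0 T z →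
      ∀ t : ℝ, t0 ≤ t → (t : EReal) < T → z t ≤ β z0 (t - t0)

/-- The family of comparison systems is strongly GUAS. -/
def CompStrongGUAS {Λ : Type*} (γ : Λ → Set ℝ) (vφ al : Λ → ℝ → ℝ → ℝ) : Prop :=
  ∃ β : ℝ → ℝ → ℝ, ClassKL β ∧
    ∀ (l : Λ) (t0 z0 : ℝ) (T : EReal) (z : ℝ → ℝ), 0 ≤ t0 → 0 ≤ z0 →
      IsCompSol (γ l) (vφ l) (al l) t0 z0 T z →
      ∀ t : ℝ, t0 ≤ t → (t : EReal) < T → z t ≤ β z0 (t - t0 + (nJumps (γ l) t0 t : ℝ))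

/-- Nonnegative Carathéodory solution of the scalar ODE `ẇ = rhs(t,w)` on `[t0,T)`. -/
structure IsODESol (rhs : ℝ → ℝ → ℝ) (t0 : ℝ) (T : EReal) (w : ℝ → ℝ) : Prop where
  lt : (t0 : EReal) < T
  nonneg : ∀ t : ℝ, t0 ≤ t → (t : EReal) < T → 0 ≤ w t
  flow : ∀ t1 t2 : ℝ, t0 ≤ t1 → t1 ≤ t2 → (t2 : EReal) < T →
    IntervalIntegrable (fun s => rhs s (w s)) MeasureTheory.volume t1 t2 ∧
    w t2 = w t1 + ∫ s in t1..t2, rhs s (w s)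

/-- Maximally defined forward-in-time solution of `ẇ = rhs(t,w)`. -/
def IsMaxODESol (rhs : ℝ → ℝ → ℝ) (t0 : ℝ) (T : EReal) (w : ℝ → ℝ) : Prop :=
  IsODESol rhs t0 T w ∧
    ∀ (T' : EReal) (w' : ℝ → ℝ), IsODESol rhs t0 T' w' →
      (∀ t : ℝ, t0 ≤ t → (t : EReal) < T → w' t = w t) → T' ≤ T

/-- GUAS of the family of scalar ODEs `ẇ = −φ_λ(t,w)`. -/
def ODEFamilyGUAS {Λ : Type*} (vφ : Λ → ℝ → ℝ → ℝ) : Prop :=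
  ∃ β : ℝ → ℝ → ℝ, ClassKL β ∧
    ∀ (l : Λ) (t0 : ℝ) (T : EReal) (w : ℝ → ℝ), 0 ≤ t0 →
      IsMaxODESol (fun s r => -(vφ l s r)) t0 T w →
      T = (⊤ : EReal) ∧ ∀ t : ℝ, t0 ≤ t → w t ≤ β (w t0) (t - t0)

/-- Solution (on all of `[0,∞)`) of the scalar linear ODE `ẇ = −p(t)·w`. -/
def IsLinSol (p : ℝ → ℝ) (w : ℝ → ℝ) : Prop :=
  ∀ t1 t2 : ℝ, 0 ≤ t1 → t1 ≤ t2 →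
    IntervalIntegrable (fun s => p s * w s) MeasureTheory.volume t1 t2 ∧
    w t2 = w t1 + ∫ s in t1..t2, -(p s * w s)

/-- An impulsive and switching sequence, described through its impulse-time set,
its two switching signals (constant between impulses), and the left limit of the
first switching signal at impulse times. -/
structure SwSignal (Ic Id : Type*) where
  γ : Set ℝ
  σ1 : ℝ → Ic
  σ1m : ℝ → Ic
  σ2 : ℝ → Id
  impulse : IsImpulseSeq γ
  const1 : ∀ a b : ℝ, 0 ≤ a → Set.Ioo a b ∩ γ = ∅ → ∀ t ∈ Set.Ico a b, σ1 t = σ1 a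
  const2 : ∀ a b : ℝ, 0 ≤ a → Set.Ioo a b ∩ γ = ∅ → ∀ t ∈ Set.Ico a b, σ2 t = σ2 a
  leftlim : ∀ t ∈ γ, ∀ᶠ s in nhdsWithin t (Set.Iio t), σ1 s = σ1m t

/-- `σ ∈ SW(J)`. -/
def InSW {Ic Id : Type*} (σ : SwSignal Ic Id) (J : Set (Ic × Ic × Id)) : Prop :=
  ∀ t ∈ σ.γ, (σ.σ1m t, σ.σ1 t, σ.σ2 t) ∈ J

/-- Flow map of the switched impulsive system `Σ_σ`. -/
def swF {n m : ℕ} {Ic Id : Type*} (F : Ic → ℝ → Stt n → Stt m → Stt n)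
    (σ : SwSignal Ic Id) : ℝ → Stt n → Stt m → Stt n :=
  fun t ξ μ => F (σ.σ1 t) t ξ μ

/-- Jump map of the switched impulsive system `Σ_σ`. -/
def swG {n m : ℕ} {Ic Id : Type*} (G : Id → ℝ → Stt n → Stt m → Stt n)
    (σ : SwSignal Ic Id) : ℝ → Stt n → Stt m → Stt n :=
  fun t ξ μ => G (σ.σ2 t) t ξ μ

/-- Weak `(h⁰,h)`-ISS of the family `{Σ_σ}_{σ ∈ SW}`. -/
def SwWeaklyISS {n m : ℕ} {Ic Id : Type*} (F : Ic → ℝ → Stt n → Stt m → Stt n)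
    (G : Id → ℝ → Stt n → Stt m → Stt n) (SW : Set (SwSignal Ic Id))
    (h0 h : ℝ → Stt n → ℝ) : Prop :=
  ∃ β : ℝ → ℝ → ℝ, ∃ ρ : ℝ → ℝ, ClassKL β ∧ ClassKInf ρ ∧
    ∀ σ ∈ SW, ∀ (t0 : ℝ) (x0 : Stt n) (u : ℝ → Stt m) (T : EReal) (x : ℝ → Stt n),
      0 ≤ t0 → IsInput u → IsMaxSolution σ.γ (swF F σ) (swG G σ) t0 x0 u T x →
      ∀ t : ℝ, t0 ≤ t → (t : EReal) < T →
        h t (x t) ≤ β (h0 t0 x0) (t - t0) + ρ (inputNorm σ.γ u (Set.Ioc t0 t))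

/-- Strong `(h⁰,h)`-ISS of the family `{Σ_σ}_{σ ∈ SW}`. -/
def SwStronglyISS {n m : ℕ} {Ic Id : Type*} (F : Ic → ℝ → Stt n → Stt m → Stt n)
    (G : Id → ℝ → Stt n → Stt m → Stt n) (SW : Set (SwSignal Ic Id))
    (h0 h : ℝ → Stt n → ℝ) : Prop :=
  ∃ β : ℝ → ℝ → ℝ, ∃ ρ : ℝ → ℝ, ClassKL β ∧ ClassKInf ρ ∧
    ∀ σ ∈ SW, ∀ (t0 : ℝ) (x0 : Stt n) (u : ℝ → Stt m) (T : EReal) (x : ℝ → Stt n),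
      0 ≤ t0 → IsInput u → IsMaxSolution σ.γ (swF F σ) (swG G σ) t0 x0 u T x →
      ∀ t : ℝ, t0 ≤ t → (t : EReal) < T →
        h t (x t) ≤ β (h0 t0 x0) (t - t0 + (nJumps σ.γ t0 t : ℝ)) +
          ρ (inputNorm σ.γ u (Set.Ioc t0 t))

/-- Total activation time in `(t0,t]` of the flow modes in `A`. -/
def actT {Ic Id : Type*} (σ : SwSignal Ic Id) (A : Set Ic) (t0 t : ℝ) : ℝ :=
  (MeasureTheory.volume {r : ℝ | r ∈ Set.Ioc t0 t ∧ σ.σ1 r ∈ A}).toReal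

/-- Number of impulse times in `(t0,t]` whose mode combination lies in `Jp`. -/
def nJumpsIn {Ic Id : Type*} (σ : SwSignal Ic Id) (Jp : Set (Ic × Ic × Id))
    (t0 t : ℝ) : ℕ :=
  (σ.γ ∩ Set.Ioc t0 t ∩ {r : ℝ | (σ.σ1m r, σ.σ1 r, σ.σ2 r) ∈ Jp}).ncard

/-- Assumption 2 of the paper (for switched impulsive systems), data explicit. -/
def Assumption2 {n m : ℕ} {Ic Id : Type*}
    (F : Ic → ℝ → Stt n → Stt m → Stt n) (G : Id → ℝ → Stt n → Stt m → Stt n)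
    (h0 h : ℝ → Stt n → ℝ) (J : Set (Ic × Ic × Id))
    (v : Ic → ℝ → Stt n → ℝ) (φ1 φ2 χ π : ℝ → ℝ)
    (vφ : Ic → ℝ → ℝ → ℝ) (al : Ic × Ic × Id → ℝ → ℝ → ℝ) : Prop :=
  ClassKInf φ1 ∧ ClassKInf φ2 ∧ ClassKInf χ ∧ ClassKInf π ∧
  (∀ i : Ic, LocLipschitzOn ((Set.Ici (0 : ℝ)) ×ˢ (Set.univ : Set (Stt n)))
      (fun q : ℝ × Stt n => v i q.1 q.2)) ∧
  (∀ i : Ic, Caratheodory2 (vφ i)) ∧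
  (∀ e ∈ J, ∀ t r : ℝ, 0 ≤ t → 0 ≤ r → 0 ≤ al e t r) ∧
  (∀ (i : Ic) (t : ℝ) (ξ : Stt n), 0 ≤ t →
    φ1 (h t ξ) ≤ v i t ξ ∧ v i t ξ ≤ φ2 (h0 t ξ)) ∧
  (∀ (i : Ic) (t : ℝ) (ξ : Stt n) (μ : Stt m), 0 ≤ t → χ ‖μ‖ ≤ v i t ξ →
    DiniAlong (F i) (v i) t ξ μ ≤ - vφ i t (v i t ξ)) ∧
  (∀ (ι i : Ic) (j : Id), (ι, i, j) ∈ J → ∀ (t : ℝ) (ξ : Stt n) (μ : Stt m),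
    0 ≤ t → χ ‖μ‖ ≤ v ι t ξ → v i t (ξ + G j t ξ μ) ≤ al (ι, i, j) t (v ι t ξ)) ∧
  (∀ (ι i : Ic) (j : Id), (ι, i, j) ∈ J → ∀ (t : ℝ) (ξ : Stt n) (μ : Stt m),
    0 ≤ t → v ι t ξ ≤ χ ‖μ‖ → v i t (ξ + G j t ξ μ) ≤ π ‖μ‖)

theorem AbsolutelyContinuousOnInterval.of_dist_le {X Y : Type*} [PseudoMetricSpace X]
    [PseudoMetricSpace Y] {f : ℝ → X} {g : ℝ → Y} {a b K : ℝ}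
    (hg : AbsolutelyContinuousOnInterval g a b)
    (hfg : ∀ s ∈ uIcc a b, ∀ t ∈ uIcc a b, dist (f s) (f t) ≤ K * dist (g s) (g t)) :
    AbsolutelyContinuousOnInterval f a b := by
  unfold AbsolutelyContinuousOnInterval at hg ⊢
  have hlim := hg.const_mul K
  rw [mul_zero] at hlim
  refine squeeze_zero' (Eventually.of_forall fun E => Finset.sum_nonneg fun _ _ => dist_nonneg)
    ?_ hlim
  filter_upwards [mem_inf_of_right (mem_principal_self _)] with E hE
  rw [Finset.mul_sum]
  exact Finset.sum_le_sum fun i hi => hfg _ (hE.1 i hi).1 _ (hE.1 i hi).2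

theorem AbsolutelyContinuousOnInterval.le_of_ae_deriv_nonpos {z : ℝ → ℝ} {a b : ℝ} (hab : a ≤ b)
    (hz : AbsolutelyContinuousOnInterval z a b)
    (hz' : ∀ᵐ t, t ∈ Ioo a b → deriv z t ≤ 0) : z b ≤ z a := by
  have h1 := hz.integral_deriv_eq_sub
  have h2 : ∫ t in a..b, deriv z t ≤ 0 := by
    rw [intervalIntegral.integral_of_le hab, integral_Ioc_eq_integral_Ioo]
    refine integral_nonpos_of_ae ?_
    rwa [EventuallyLE, ae_restrict_iff' measurableSet_Ioo]
  linarith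

/-- The integrating factor attached to the rate `p` and the base point `a`. -/
def intFactor (p : ℝ → ℝ) (a t : ℝ) : ℝ := Real.exp (∫ s in a..t, p s)

theorem continuous_intFactor {p : ℝ → ℝ} (hp : ∀ a b : ℝ, IntervalIntegrable p volume a b)
    (a : ℝ) : Continuous (intFactor p a) :=
  Real.continuous_exp.comp (intervalIntegral.continuous_primitive hp a)

theorem absolutelyContinuous_intFactor {p : ℝ → ℝ}
    (hp : ∀ a b : ℝ, IntervalIntegrable p volume a b) (a b c : ℝ) (hc : c ∈ uIcc a b) :
    AbsolutelyContinuousOnInterval (intFactor p c) a b := by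
  have hP := (hp a b).absolutelyContinuousOnInterval_intervalIntegral hc
  obtain ⟨M, hM⟩ := hP.exists_bound
  obtain ⟨K, hK⟩ := (Real.contDiff_exp (n := 1)).contDiffOn.exists_lipschitzOnWith (by decide)
    (convex_Icc (-M) M) isCompact_Icc
  exact hP.of_dist_le (K := K) fun s hs t ht =>
    hK.dist_le_mul _ (abs_le.1 (hM s hs)) _ (abs_le.1 (hM t ht))

theorem ae_hasDerivAt_intFactor {p : ℝ → ℝ} (hp : ∀ a b : ℝ, IntervalIntegrable p volume a b) :
    ∀ᵐ t, ∀ a, HasDerivAt (intFactor p a) (intFactor p a t * p t) t := by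
  have hloc : LocallyIntegrable p volume := fun x =>
    ⟨Icc (x - 1) (x + 1), Icc_mem_nhds (by linarith) (by linarith), by
      rw [integrableOn_Icc_iff_integrableOn_Ioc]
      exact ((intervalIntegrable_iff_integrableOn_Ioc_of_le (by linarith)).1 (hp _ _))⟩
  filter_upwards [LocallyIntegrable.ae_hasDerivAt_integral hloc] with t ht a
  exact (ht a).exp

/-- Grönwall estimate for absolutely continuous functions with an integrable rate. -/
theorem AbsolutelyContinuousOnInterval.le_exp_mul_of_ae_deriv_le {p z : ℝ → ℝ} {a b : ℝ}
    (hp : ∀ a b : ℝ, IntervalIntegrable p volume a b) (hab : a ≤ b)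
    (hz : AbsolutelyContinuousOnInterval z a b)
    (hz' : ∀ᵐ t, t ∈ Ioo a b → deriv z t ≤ -(p t * z t)) :
    z b ≤ Real.exp (-∫ s in a..b, p s) * z a := by
  have hE := absolutelyContinuous_intFactor hp a b a left_mem_uIcc
  have key := (hE.mul hz).le_of_ae_deriv_nonpos hab (by
    filter_upwards [hz', hz.ae_differentiableAt, ae_hasDerivAt_intFactor hp] with t h1 h2 h3 ht
    have h4 := ((h3 a).mul (h2 (by rw [uIcc_of_le hab]; exact Ioo_subset_Icc_self ht)).hasDerivAt)
    rw [h4.deriv]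
    have h5 := mul_le_mul_of_nonneg_left (h1 ht) (Real.exp_pos (∫ s in a..t, p s)).le
    simp only [intFactor]
    linarith)
  simp only [Pi.mul_apply, intFactor, intervalIntegral.integral_same, Real.exp_zero,
    one_mul] at key
  rw [Real.exp_neg, inv_mul_eq_div, le_div_iff₀ (Real.exp_pos _)]
  linarith

/-- Alternative for a continuous function which decays at rate `p` while it exceeds a threshold. -/
theorem le_exp_mul_or_exists_le_exp_mul {p z : ℝ → ℝ} {a b C : ℝ}
    (hp : ∀ a b : ℝ, IntervalIntegrable p volume a b) (hab : a ≤ b)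
    (hcont : ContinuousOn z (Icc a b))
    (hz : ∀ b' ∈ Ico a b, AbsolutelyContinuousOnInterval z a b')
    (hz' : ∀ b' ∈ Ico a b, ∀ᵐ t, t ∈ Ioo a b' → C < z t → deriv z t ≤ -(p t * z t)) :
    z b ≤ Real.exp (-∫ s in a..b, p s) * z a ∨
      ∃ s ∈ Icc a b, z b ≤ Real.exp (-∫ r in s..b, p r) * C := by
  have decay : ∀ s ∈ Icc a b, (∀ t ∈ Ioo s b, C < z t) →
      z b ≤ Real.exp (-∫ r in s..b, p r) * z s := by
    intro s hs hC
    rcases hs.2.eq_or_lt with rfl | hsb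
    · simp
    have h1 : ∀ t ∈ Ioo s b, z t ≤ Real.exp (-∫ r in s..t, p r) * z s := by
      intro t ht
      refine AbsolutelyContinuousOnInterval.le_exp_mul_of_ae_deriv_le hp ht.1.le
        ((hz t ⟨hs.1.trans ht.1.le, ht.2⟩).mono ?_) ?_
      · rw [uIcc_of_le ht.1.le, uIcc_of_le (hs.1.trans ht.1.le)]
        exact Icc_subset_Icc_left hs.1
      · filter_upwards [hz' t ⟨hs.1.trans ht.1.le, ht.2⟩] with r hr hrt
        exact hr ⟨hs.1.trans_lt hrt.1, hrt.2⟩ (hC r ⟨hrt.1, hrt.2.trans ht.2⟩)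
    have hb : b ∈ Icc a b := right_mem_Icc.2 hab
    have h2 : Tendsto z (nhdsWithin b (Ioo s b)) (nhds (z b)) :=
      (hcont b hb).mono_left (nhdsWithin_mono _ fun r hr => ⟨hs.1.trans hr.1.le, hr.2.le⟩)
    have h3 : Tendsto (fun t => Real.exp (-∫ r in s..t, p r) * z s) (nhdsWithin b (Ioo s b))
        (nhds (Real.exp (-∫ r in s..b, p r) * z s)) := by
      have h4 : Continuous fun t => Real.exp (-∫ r in s..t, p r) * z s :=
        (Real.continuous_exp.comp (intervalIntegral.continuous_primitive hp s).neg).mul_const _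
      exact (h4.tendsto b).mono_left nhdsWithin_le_nhds
    have : (nhdsWithin b (Ioo s b)).NeBot := by
      rw [nhdsWithin_Ioo_eq_nhdsLT hsb]; infer_instance
    exact le_of_tendsto_of_tendsto h2 h3 (eventually_nhdsWithin_of_forall h1)
  by_cases hex : ∃ s ∈ Icc a b, z s ≤ C
  · right
    have hclosed : IsCompact (Icc a b ∩ z ⁻¹' Iic C) :=
      isCompact_Icc.of_isClosed_subset (hcont.preimage_isClosed_of_isClosed isClosed_Icc isClosed_Iic)
        inter_subset_left
    obtain ⟨s, ⟨hs, hsC⟩, hmax⟩ := hclosed.exists_isGreatest hex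
    refine ⟨s, hs, (decay s hs fun t ht => ?_).trans
      (mul_le_mul_of_nonneg_left hsC (Real.exp_pos _).le)⟩
    by_contra! hle
    exact absurd (hmax ⟨⟨hs.1.trans ht.1.le, ht.2.le⟩, hle⟩) (not_le.2 ht.1)
  · left
    push Not at hex
    exact decay a (left_mem_Icc.2 hab) fun t ht => hex t (Ioo_subset_Icc_self ht)

/-- The function `exp (-∫₀ᵗ p)` solves `ẇ = -p w`. -/
theorem isLinSol_exp_neg_integral {p : ℝ → ℝ} (hp : ∀ a b : ℝ, IntervalIntegrable p volume a b) :
    IsLinSol p fun t => Real.exp (-∫ s in (0 : ℝ)..t, p s) := by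
  intro t1 t2 h1 h12
  have hn : ∀ a b : ℝ, IntervalIntegrable (-p) volume a b := fun a b => (hp a b).neg
  have hw : (fun t => Real.exp (-∫ s in (0 : ℝ)..t, p s)) = intFactor (-p) 0 := by
    funext t
    simp [intFactor, intervalIntegral.integral_neg]
  have hac := (absolutelyContinuous_intFactor hn 0 t2 0 left_mem_uIcc).mono (c := t1) (d := t2) (by
    rw [uIcc_of_le h12, uIcc_of_le (h1.trans h12)]
    exact Icc_subset_Icc_left h1)
  rw [hw]
  refine ⟨(hp t1 t2).mul_continuousOn (continuous_intFactor hn 0).continuousOn, ?_⟩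
  have h3 := hac.integral_deriv_eq_sub
  have h4 : ∫ s in t1..t2, -(p s * intFactor (-p) 0 s) = ∫ s in t1..t2, deriv (intFactor (-p) 0) s := by
    refine intervalIntegral.integral_congr_ae ?_
    filter_upwards [ae_hasDerivAt_intFactor hn] with t ht _
    rw [(ht 0).deriv, Pi.neg_apply]
    ring
  rw [h4, h3]
  ring

namespace ClassKInf

theorem nonneg {α : ℝ → ℝ} (hα : ClassKInf α) {r : ℝ} (hr : 0 ≤ r) : 0 ≤ α r := by
  have := hα.2.1.monotoneOn self_mem_Ici hr hr
  rwa [hα.2.2.1] at this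

theorem mono {α : ℝ → ℝ} (hα : ClassKInf α) {r s : ℝ} (hr : 0 ≤ r) (hrs : r ≤ s) : α r ≤ α s :=
  hα.2.1.monotoneOn hr (hr.trans hrs) hrs

theorem mapsTo {α : ℝ → ℝ} (hα : ClassKInf α) : MapsTo α (Ici 0) (Ici 0) := fun _ hr =>
  hα.nonneg hr

theorem comp {α β : ℝ → ℝ} (hα : ClassKInf α) (hβ : ClassKInf β) :
    ClassKInf fun r => α (β r) := by
  refine ⟨hα.1.comp hβ.1 hβ.mapsTo, hα.2.1.comp hβ.2.1 hβ.mapsTo, by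
    simp [hβ.2.2.1, hα.2.2.1], fun M => ?_⟩
  obtain ⟨s, hs, hM⟩ := hα.2.2.2 M
  obtain ⟨r, hr, hsr⟩ := hβ.2.2.2 s
  exact ⟨r, hr, hM.trans (hα.mono hs hsr)⟩

theorem const_mul {α : ℝ → ℝ} (hα : ClassKInf α) {A : ℝ} (hA : 0 < A) :
    ClassKInf fun r => A * α r := by
  refine ⟨hα.1.const_mul A |>.congr fun _ _ => rfl, fun r hr s hs hrs =>
    mul_lt_mul_of_pos_left (hα.2.1 hr hs hrs) hA, by simp [hα.2.2.1], fun M => ?_⟩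
  obtain ⟨r, hr, hM⟩ := hα.2.2.2 (M / A)
  exact ⟨r, hr, by rwa [div_le_iff₀' hA] at hM⟩

theorem add {α β : ℝ → ℝ} (hα : ClassKInf α) (hβ : ClassKInf β) :
    ClassKInf fun r => α r + β r := by
  refine ⟨hα.1.add hβ.1, fun r hr s hs hrs => add_lt_add (hα.2.1 hr hs hrs) (hβ.2.1 hr hs hrs),
    by simp [hα.2.2.1, hβ.2.2.1], fun M => ?_⟩
  obtain ⟨r, hr, hM⟩ := hα.2.2.2 M
  exact ⟨r, hr, hM.trans (le_add_of_nonneg_right (hβ.nonneg hr))⟩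

theorem image_Ici {α : ℝ → ℝ} (hα : ClassKInf α) : α '' Ici 0 = Ici 0 := by
  refine Subset.antisymm hα.mapsTo.image_subset fun s hs => ?_
  obtain ⟨r, hr, hsr⟩ := hα.2.2.2 s
  obtain ⟨q, hq, hqs⟩ := intermediate_value_Icc hr (hα.1.mono Icc_subset_Ici_self)
    (show s ∈ Icc (α 0) (α r) from ⟨by rw [hα.2.2.1]; exact hs, hsr⟩)
  exact ⟨q, hq.1, hqs⟩

theorem exists_leftInverse {α : ℝ → ℝ} (hα : ClassKInf α) :
    ∃ β : ℝ → ℝ, ClassKInf β ∧ ∀ r, 0 ≤ r → β (α r) = r := by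
  have hinj : InjOn α (Ici 0) := hα.2.1.injOn
  have hsurj : SurjOn α (Ici 0) (Ici 0) := hα.image_Ici.ge
  set β := Function.invFunOn α (Ici 0)
  have hleft : ∀ r, 0 ≤ r → β (α r) = r := fun r hr => hinj.leftInvOn_invFunOn hr
  have hright : ∀ s, 0 ≤ s → α (β s) = s := fun s hs => hsurj.rightInvOn_invFunOn hs
  have hmem : ∀ s, 0 ≤ s → 0 ≤ β s := fun s hs => hsurj.mapsTo_invFunOn hs
  have hmono : StrictMonoOn β (Ici 0) := fun s hs t ht hst => by
    rw [← hα.2.1.lt_iff_lt (hmem s hs) (hmem t ht), hright s hs, hright t ht]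
    exact hst
  have himage : β '' Ici 0 = Ici 0 := Subset.antisymm (by rintro _ ⟨s, hs, rfl⟩; exact hmem s hs)
    fun r hr => ⟨α r, hα.nonneg hr, hleft r hr⟩
  refine ⟨β, ⟨?_, hmono, ?_, fun M => ?_⟩, hleft⟩
  · have hcont : Continuous (hmono.orderIso β (Ici 0)) := by
      have : OrdConnected (β '' Ici 0) := by rw [himage]; exact ordConnected_Ici
      exact (hmono.orderIso β (Ici 0)).continuous
    rw [continuousOn_iff_continuous_domRestrict]
    exact continuous_subtype_val.comp hcont
  · have := hleft 0 le_rfl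
    rwa [hα.2.2.1] at this
  · refine ⟨α (max M 0), hα.nonneg (le_max_right _ _), ?_⟩
    rw [hleft _ (le_max_right _ _)]
    exact le_max_left _ _

theorem tendsto_zero {α : ℝ → ℝ} (hα : ClassKInf α) {ι : Type*} {F : Filter ι} {g : ι → ℝ}
    (hg : Tendsto g F (nhds 0)) (hg0 : ∀ i, 0 ≤ g i) :
    Tendsto (fun i => α (g i)) F (nhds 0) := by
  have h := hα.1 0 self_mem_Ici
  rw [ContinuousWithinAt, hα.2.2.1] at h
  exact h.comp (tendsto_nhdsWithin_iff.2 ⟨hg, Eventually.of_forall hg0⟩)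

end ClassKInf

theorem classKL_comp_exp {α β : ℝ → ℝ} (hα : ClassKInf α) (hβ : ClassKInf β) {A η : ℝ}
    (hA : 0 < A) (hη : 0 < η) :
    ClassKL fun r t => α (A * Real.exp (-(η * t)) * β r) := by
  refine ⟨fun t _ => hα.comp (hβ.const_mul (by positivity)), fun r hr => ⟨?_, ?_⟩⟩
  · intro s _ t _ hst
    have := hβ.nonneg hr
    refine hα.mono (by positivity) ?_
    gcongr
  · have := hβ.nonneg hr
    refine hα.tendsto_zero ?_ fun t => by positivity
    have h1 : Tendsto (fun t : ℝ => Real.exp (-(η * t))) atTop (nhds 0) :=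
      Real.tendsto_exp_neg_atTop_nhds_zero.comp (tendsto_id.const_mul_atTop hη)
    simpa using (h1.const_mul A).mul_const (β r)

theorem IsImpulseSeq.finite_inter_Ioc {γ : Set ℝ} (hγ : IsImpulseSeq γ) (s t : ℝ) :
    (γ ∩ Ioc s t).Finite :=
  (hγ.2 t).subset (inter_subset_inter_right _ Ioc_subset_Iic_self)

theorem nJumps_add {γ : Set ℝ} (hγ : IsImpulseSeq γ) {s r t : ℝ} (hsr : s ≤ r) (hrt : r ≤ t) :
    nJumps γ s r + nJumps γ r t = nJumps γ s t := by
  unfold nJumps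
  rw [← Ioc_union_Ioc_eq_Ioc hsr hrt, inter_union_distrib_left, ncard_union_eq _
    (hγ.finite_inter_Ioc s r) (hγ.finite_inter_Ioc r t)]
  exact (Ioc_disjoint_Ioc_of_le le_rfl).mono inter_subset_right inter_subset_right

theorem nJumps_eq_zero {γ : Set ℝ} {s t : ℝ} (h : Ioc s t ∩ γ = ∅) : nJumps γ s t = 0 := by
  rw [nJumps, inter_comm, h, ncard_empty]

theorem nJumps_eq_one {γ : Set ℝ} {s t : ℝ} (hst : s < t) (ht : t ∈ γ) (h : Ioo s t ∩ γ = ∅) :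
    nJumps γ s t = 1 := by
  rw [nJumps, inter_comm, ← Ioo_insert_right hst, insert_inter_of_mem ht, h]
  simp

/-- There is an impulse-free gap to the left of every time. -/
theorem IsImpulseSeq.exists_gap_left {γ : Set ℝ} (hγ : IsImpulseSeq γ) {s t : ℝ} (hst : s < t) :
    ∃ a ∈ Ico s t, Ioo a t ∩ γ = ∅ := by
  have hfin : (insert s (γ ∩ Ioo s t)).Finite :=
    ((hγ.finite_inter_Ioc s t).subset (inter_subset_inter_right _ Ioo_subset_Ioc_self)).insert s
  obtain ⟨a, ha, hmax⟩ := hfin.isCompact.exists_isGreatest (insert_nonempty _ _)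
  have hsa : s ≤ a := hmax (mem_insert _ _)
  refine ⟨a, ⟨hsa, ?_⟩, ?_⟩
  · rcases ha with rfl | ha
    exacts [hst, ha.2.2]
  · refine eq_empty_of_forall_notMem fun r hr => ?_
    exact (hmax (mem_insert_of_mem _ ⟨hr.2, hsa.trans_lt hr.1.1, hr.1.2⟩)).not_gt hr.1.1

/-- There is an impulse-free gap to the right of every time. -/
theorem IsImpulseSeq.exists_gap_right {γ : Set ℝ} (hγ : IsImpulseSeq γ) (t : ℝ) :
    ∃ b, t < b ∧ Ioo t b ∩ γ = ∅ := by
  have hfin := hγ.finite_inter_Ioc t (t + 1)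
  have hopen : IsOpen (γ ∩ Ioc t (t + 1))ᶜ := hfin.isClosed.isOpen_compl
  obtain ⟨ε, hε, hball⟩ := Metric.isOpen_iff.1 hopen t (fun h => lt_irrefl t h.2.1)
  refine ⟨t + min ε 1, by simp [hε], eq_empty_of_forall_notMem fun r hr => ?_⟩
  have h1 := min_le_left ε 1
  have h2 := min_le_right ε 1
  have hr1 := hr.1.1
  have hr2 := hr.1.2
  have hrt : r ∈ Metric.ball t ε := by
    rw [Metric.mem_ball, Real.dist_eq, abs_lt]
    constructor <;> linarith
  exact hball hrt ⟨hr.2, hr1, by linarith⟩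

/-- Growth factor over `(s,t]` of a scalar linear impulsive system with rate `-p` and jump
factor `d`. -/
def linGain (γ : Set ℝ) (p : ℝ → ℝ) (d s t : ℝ) : ℝ :=
  d ^ nJumps γ s t * Real.exp (-∫ r in s..t, p r)

theorem linGain_nonneg (γ : Set ℝ) (p : ℝ → ℝ) {d : ℝ} (hd : 0 ≤ d) (s t : ℝ) :
    0 ≤ linGain γ p d s t := by
  unfold linGain
  positivity

theorem linGain_mul {γ : Set ℝ} (hγ : IsImpulseSeq γ) {p : ℝ → ℝ}
    (hp : ∀ a b : ℝ, IntervalIntegrable p volume a b) (d : ℝ) {s r t : ℝ}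
    (hsr : s ≤ r) (hrt : r ≤ t) :
    linGain γ p d r t * linGain γ p d s r = linGain γ p d s t := by
  unfold linGain
  rw [← nJumps_add hγ hsr hrt, ← intervalIntegral.integral_add_adjacent_intervals (hp s r) (hp r t),
    neg_add, Real.exp_add, pow_add]
  ring

theorem linGain_of_no_jump {γ : Set ℝ} (p : ℝ → ℝ) (d : ℝ) {s t : ℝ} (h : Ioc s t ∩ γ = ∅) :
    linGain γ p d s t = Real.exp (-∫ r in s..t, p r) := by
  rw [linGain, nJumps_eq_zero h, pow_zero, one_mul]

theorem linGain_self (γ : Set ℝ) (p : ℝ → ℝ) (d s : ℝ) : linGain γ p d s s = 1 := by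
  rw [linGain_of_no_jump p d (by simp)]
  simp

theorem linGain_of_jump {γ : Set ℝ} (p : ℝ → ℝ) (d : ℝ) {s t : ℝ} (hst : s < t) (ht : t ∈ γ)
    (h : Ioo s t ∩ γ = ∅) :
    linGain γ p d s t = d * Real.exp (-∫ r in s..t, p r) := by
  rw [linGain, nJumps_eq_one hst ht h, pow_one]

/-- Estimates on impulse-free intervals and across impulses combine to a global estimate. -/
theorem le_linGain_mul_or_exists_le_linGain_mul {γ : Set ℝ} (hγ : IsImpulseSeq γ) {p : ℝ → ℝ}
    (hp : ∀ a b : ℝ, IntervalIntegrable p volume a b) {d C R t0 tf : ℝ} (hd : 0 ≤ d)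
    (hCR : C ≤ R) (hdCR : d * C ≤ R) {v : ℝ → ℝ}
    (hflow : ∀ a b : ℝ, t0 ≤ a → a ≤ b → b ≤ tf → Ioc a b ∩ γ = ∅ →
      v b ≤ Real.exp (-∫ s in a..b, p s) * v a ∨
        ∃ s ∈ Icc a b, v b ≤ Real.exp (-∫ r in s..b, p r) * C)
    (hjump : ∀ a b : ℝ, t0 ≤ a → a < b → b ≤ tf → b ∈ γ → Ioo a b ∩ γ = ∅ →
      v b ≤ R ∨ ∃ y, v b ≤ d * y ∧ (y ≤ Real.exp (-∫ s in a..b, p s) * v a ∨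
        ∃ s ∈ Icc a b, y ≤ Real.exp (-∫ r in s..b, p r) * C)) :
    ∀ t, t0 ≤ t → t ≤ tf → v t ≤ linGain γ p d t0 t * v t0 ∨
      ∃ s ∈ Icc t0 t, v t ≤ linGain γ p d s t * R := by
  have step : ∀ a b : ℝ, t0 ≤ a → a ≤ b →
      (v a ≤ linGain γ p d t0 a * v t0 ∨ ∃ s ∈ Icc t0 a, v a ≤ linGain γ p d s a * R) →
      v b ≤ linGain γ p d a b * v a →
      (v b ≤ linGain γ p d t0 b * v t0 ∨ ∃ s ∈ Icc t0 b, v b ≤ linGain γ p d s b * R) := by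
    intro a b ha hab hva hvb
    have hg := linGain_nonneg γ p hd a b
    rcases hva with h | ⟨s, hs, h⟩
    · left
      rw [← linGain_mul hγ hp d ha hab, mul_assoc]
      exact hvb.trans (mul_le_mul_of_nonneg_left h hg)
    · right
      refine ⟨s, ⟨hs.1, hs.2.trans hab⟩, ?_⟩
      rw [← linGain_mul hγ hp d hs.2 hab, mul_assoc]
      exact hvb.trans (mul_le_mul_of_nonneg_left h hg)
  have flowStep : ∀ a b : ℝ, t0 ≤ a → a ≤ b → b ≤ tf → Ioc a b ∩ γ = ∅ →
      (v a ≤ linGain γ p d t0 a * v t0 ∨ ∃ s ∈ Icc t0 a, v a ≤ linGain γ p d s a * R) →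
      (v b ≤ linGain γ p d t0 b * v t0 ∨ ∃ s ∈ Icc t0 b, v b ≤ linGain γ p d s b * R) := by
    intro a b ha hab hb hnj hva
    rcases hflow a b ha hab hb hnj with h | ⟨s, hs, h⟩
    · exact step a b ha hab hva (by rwa [linGain_of_no_jump p d hnj])
    · right
      refine ⟨s, ⟨ha.trans hs.1, hs.2⟩, ?_⟩
      rw [linGain_of_no_jump p d (subset_empty_iff.1
        ((inter_subset_inter_left _ (Ioc_subset_Ioc_left hs.1)).trans hnj.subset))]
      exact h.trans (mul_le_mul_of_nonneg_left hCR (Real.exp_pos _).le)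
  intro t
  induction hk : nJumps γ t0 t using Nat.strong_induction_on generalizing t with
  | _ k ih =>
    intro ht httf
    rcases (γ ∩ Ioc t0 t).eq_empty_or_nonempty with hemp | hne
    · refine flowStep t0 t le_rfl ht httf (by rwa [inter_comm]) (Or.inl ?_)
      simp [linGain_self]
    obtain ⟨b, ⟨hbγ, hb⟩, hmax⟩ :=
      (hγ.finite_inter_Ioc t0 t).isCompact.exists_isGreatest hne
    refine flowStep b t hb.1.le hb.2 httf (eq_empty_of_forall_notMem fun r hr =>
      (hmax ⟨hr.2, hb.1.trans hr.1.1, hr.1.2⟩).not_gt hr.1.1) ?_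
    obtain ⟨a, ha, hgap⟩ := hγ.exists_gap_left hb.1
    have hva := ih (nJumps γ t0 a) (by
      rw [← hk, ← nJumps_add hγ ha.1 (ha.2.le.trans hb.2), ← nJumps_add hγ ha.2.le hb.2,
        nJumps_eq_one ha.2 hbγ hgap]
      omega) a rfl ha.1 (ha.2.le.trans (hb.2.trans httf))
    have hR : v b ≤ R → v b ≤ linGain γ p d t0 b * v t0 ∨
        ∃ s ∈ Icc t0 b, v b ≤ linGain γ p d s b * R := fun h =>
      Or.inr ⟨b, ⟨hb.1.le, le_rfl⟩, by rwa [linGain_self, one_mul]⟩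
    rcases hjump a b ha.1 ha.2 (hb.2.trans httf) hbγ hgap with h | ⟨y, hvy, h | ⟨s, hs, h⟩⟩
    · exact hR h
    · refine step a b ha.1 ha.2.le hva ?_
      rw [linGain_of_jump p d ha.2 hbγ hgap, mul_assoc]
      exact hvy.trans (mul_le_mul_of_nonneg_left h hd)
    · rcases hs.2.eq_or_lt with rfl | hsb
      · refine hR (hvy.trans ((mul_le_mul_of_nonneg_left h hd).trans ?_))
        simpa using hdCR
      · right
        refine ⟨s, ⟨ha.1.trans hs.1, hs.2⟩, ?_⟩
        rw [linGain_of_jump p d hsb hbγ (subset_empty_iff.1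
          ((inter_subset_inter_left _ (Ioo_subset_Ioo_left hs.1)).trans hgap.subset)), mul_assoc]
        exact hvy.trans (mul_le_mul_of_nonneg_left
          (h.trans (mul_le_mul_of_nonneg_left hCR (Real.exp_pos _).le)) hd)

theorem linGain_le {γ : Set ℝ} {p : ℝ → ℝ} (hp : ∀ a b : ℝ, IntervalIntegrable p volume a b)
    {d κ c η μ : ℝ} (hd : 0 ≤ d) (hκ : 0 < κ)
    (hlin : ∀ w : ℝ → ℝ, IsLinSol p w →
      ∀ t0 t : ℝ, 0 ≤ t0 → t0 ≤ t → |w t| ≤ κ * Real.exp (-(c * (t - t0))) * |w t0|)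
    (hcond : ∀ t0 t : ℝ, 0 ≤ t0 → t0 ≤ t → (0 < d ∨ nJumps γ t0 t = 0) →
      (nJumps γ t0 t : ℝ) * Real.log d - (c - η) * (t - t0) ≤ μ)
    {s t : ℝ} (hs : 0 ≤ s) (hst : s ≤ t) :
    linGain γ p d s t ≤ κ * Real.exp μ * Real.exp (-(η * (t - s))) := by
  have h1 : Real.exp (-∫ r in s..t, p r) ≤ κ * Real.exp (-(c * (t - s))) := by
    have h := hlin _ (isLinSol_exp_neg_integral hp) s t hs hst
    rw [abs_of_pos (Real.exp_pos _), abs_of_pos (Real.exp_pos _), ← div_le_iff₀ (Real.exp_pos _),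
      ← Real.exp_sub, ← intervalIntegral.integral_add_adjacent_intervals (hp 0 s) (hp s t)] at h
    exact (congrArg Real.exp (by ring)).trans_le h
  unfold linGain
  by_cases hj : 0 < d ∨ nJumps γ s t = 0
  · have h2 : d ^ nJumps γ s t = Real.exp (nJumps γ s t * Real.log d) := by
      rcases hj with hd | h0
      · rw [Real.exp_nat_mul, Real.exp_log hd]
      · simp [h0]
    calc d ^ nJumps γ s t * Real.exp (-∫ r in s..t, p r)
        ≤ Real.exp (nJumps γ s t * Real.log d) * (κ * Real.exp (-(c * (t - s)))) := by
          rw [h2]; gcongr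
      _ = κ * Real.exp (nJumps γ s t * Real.log d - c * (t - s)) := by
          rw [sub_eq_add_neg _ (c * (t - s)), Real.exp_add]; ring
      _ ≤ κ * Real.exp (μ + -(η * (t - s))) := by
          have := hcond s t hs hst hj
          gcongr
          linarith
      _ = κ * Real.exp μ * Real.exp (-(η * (t - s))) := by rw [Real.exp_add]; ring
  · push Not at hj
    rw [le_antisymm hj.1 hd, zero_pow hj.2, zero_mul]
    positivity

/-- The derivative of `V` along a differentiable curve equals the derivative of the difference
quotient along the tangent direction. -/
theorem hasDerivAt_along_tangent {E : Type*} [NormedAddCommGroup E] [NormedSpace ℝ E]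
    {V : ℝ → E → ℝ} {x : ℝ → E} {t v' : ℝ} {y : E} {K : NNReal} {S : Set (ℝ × E)}
    (hS : S ∈ nhds (t, x t)) (hV : LipschitzOnWith K (fun q : ℝ × E => V q.1 q.2) S)
    (hx : HasDerivAt x y t) (hv : HasDerivAt (fun s => V s (x s)) v' t) :
    HasDerivAt (fun h : ℝ => V (t + h) (x t + h • y)) v' 0 := by
  rw [hasDerivAt_iff_isLittleO_nhds_zero] at hx hv ⊢
  have hshift : Tendsto (fun h : ℝ => t + h) (nhds 0) (nhds t) :=
    Continuous.tendsto' (by fun_prop) _ _ (by simp)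
  have htan : Tendsto (fun h : ℝ => x t + h • y) (nhds 0) (nhds (x t)) :=
    Continuous.tendsto' (by fun_prop) _ _ (by simp)
  have hxc : Tendsto (fun h : ℝ => x (t + h)) (nhds 0) (nhds (x t)) := by
    have h1 : Tendsto (fun h : ℝ => x (t + h) - x t - h • y) (nhds 0) (nhds 0) :=
      hx.trans_tendsto tendsto_id
    have h2 := (h1.add htan).congr fun h => show _ = x (t + h) by abel
    rwa [zero_add] at h2
  have h1 := (hshift.prodMk_nhds hxc).eventually hS
  have h2 := (hshift.prodMk_nhds htan).eventually hS
  have hdiff : (fun h : ℝ => V (t + h) (x t + h • y) - V (t + h) (x (t + h))) =o[nhds 0]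
      fun h : ℝ => h := by
    refine Asymptotics.IsBigO.trans_isLittleO (Asymptotics.IsBigO.of_bound K ?_) hx
    filter_upwards [h1, h2] with h h1 h2
    have h3 := hV.dist_le_mul _ h2 _ h1
    rw [Real.dist_eq, ← Real.norm_eq_abs, Prod.dist_eq, dist_self,
      max_eq_right dist_nonneg, dist_comm, dist_eq_norm] at h3
    rwa [sub_sub]
  refine (hdiff.add hv).congr_left fun h => ?_
  simp
  ring

/-- Along a Carathéodory trajectory, a locally Lipschitz function with the Dini derivative bound
above a threshold decays at the given rate above this threshold. -/
theorem lyapunov_flow_alternative {n : ℕ} {V : ℝ → Stt n → ℝ} {x F : ℝ → Stt n} {p z : ℝ → ℝ}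
    {a b C : ℝ} (hp : ∀ a b : ℝ, IntervalIntegrable p volume a b) (hab : a ≤ b)
    (hV : LocLipschitzOn (Ico a b ×ˢ (univ : Set (Stt n))) (fun q : ℝ × Stt n => V q.1 q.2))
    (hx : ∀ t ∈ Ico a b, IntegrableOn F (Icc a t) ∧ x t = x a + ∫ s in a..t, F s)
    (hz : ∀ t ∈ Ico a b, z t = V t (x t)) (hcont : ContinuousOn z (Icc a b))
    (hD : ∀ᵐ t, t ∈ Ioo a b → C < V t (x t) →
      limsup (fun h : ℝ => (V (t + h) (x t + h • F t) - V t (x t)) / h)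
        (nhdsWithin 0 (Ioi 0)) ≤ -(p t * V t (x t))) :
    z b ≤ Real.exp (-∫ s in a..b, p s) * z a ∨
      ∃ s ∈ Icc a b, z b ≤ Real.exp (-∫ r in s..b, p r) * C := by
  have hFint : ∀ b' ∈ Ico a b, IntervalIntegrable F volume a b' := fun b' hb' =>
    (intervalIntegrable_iff_integrableOn_Icc_of_le hb'.1).2 (hx b' hb').1
  have hac : ∀ b' ∈ Ico a b, AbsolutelyContinuousOnInterval z a b' := by
    intro b' hb'
    have hsub : Icc a b' ⊆ Ico a b := fun s hs => ⟨hs.1, hs.2.trans_lt hb'.2⟩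
    have hxcont : ContinuousOn x (Icc a b') := by
      have h1 := intervalIntegral.continuousOn_primitive_interval' (hFint b' hb') left_mem_uIcc
      rw [uIcc_of_le hb'.1] at h1
      exact (continuousOn_const.add h1).congr fun s hs => (hx s (hsub hs)).2
    have hK : IsCompact ((fun s => (s, x s)) '' Icc a b') :=
      isCompact_Icc.image_of_continuousOn (continuousOn_id.prodMk hxcont)
    have hVloc : LocallyLipschitzOn (Ico a b ×ˢ (univ : Set (Stt n)))
      (fun q : ℝ × Stt n => V q.1 q.2) := fun q hq => hV q hq
    obtain ⟨K, hKlip⟩ := (hVloc.mono (by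
      rintro _ ⟨s, hs, rfl⟩
      exact ⟨hsub hs, mem_univ _⟩)).exists_lipschitzOnWith_of_compact hK
    have hG : AbsolutelyContinuousOnInterval (fun t => t + ∫ s in a..t, ‖F s‖) a b' :=
      (contDiff_id.contDiffOn (n := 1)).absolutelyContinuousOnInterval.fun_add
        ((hFint b' hb').norm.absolutelyContinuousOnInterval_intervalIntegral left_mem_uIcc)
    refine hG.of_dist_le (K := K) ?_
    have key : ∀ s ∈ Icc a b', ∀ t ∈ Icc a b', s ≤ t → dist (z s) (z t) ≤
        K * dist (s + ∫ r in a..s, ‖F r‖) (t + ∫ r in a..t, ‖F r‖) := by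
      intro s hs t ht hst
      have hs' := hFint s (hsub hs)
      have hst' : IntervalIntegrable F volume s t := (hFint t (hsub ht)).mono_set (by
        rw [uIcc_of_le hst, uIcc_of_le ht.1]; exact Icc_subset_Icc_left hs.1)
      have hsum := intervalIntegral.integral_add_adjacent_intervals hs'.norm hst'.norm
      have hxsum := intervalIntegral.integral_add_adjacent_intervals hs' hst'
      have hnn : 0 ≤ ∫ r in s..t, ‖F r‖ :=
        intervalIntegral.integral_nonneg hst fun _ _ => norm_nonneg _
      have hxd : dist (x s) (x t) ≤ ∫ r in s..t, ‖F r‖ := by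
        rw [dist_comm, dist_eq_norm, (hx s (hsub hs)).2, (hx t (hsub ht)).2, ← hxsum]
        simpa using intervalIntegral.norm_integral_le_integral_norm hst (f := F) (μ := volume)
      rw [hz s (hsub hs), hz t (hsub ht)]
      refine (hKlip.dist_le_mul _ ⟨s, hs, rfl⟩ _ ⟨t, ht, rfl⟩).trans
        (mul_le_mul_of_nonneg_left ?_ K.2)
      have hR : dist (s + ∫ r in a..s, ‖F r‖) (t + ∫ r in a..t, ‖F r‖) =
          (t - s) + ∫ r in s..t, ‖F r‖ := by
        rw [dist_comm, Real.dist_eq, ← hsum, abs_of_nonneg (by linarith)]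
        ring
      rw [hR, Prod.dist_eq]
      refine max_le ?_ (hxd.trans (by linarith))
      rw [dist_comm, Real.dist_eq, abs_of_nonneg (by linarith)]
      linarith
    rw [uIcc_of_le hb'.1]
    intro s hs t ht
    rcases le_total s t with h | h
    · exact key s hs t ht h
    · rw [dist_comm (z s), dist_comm (s + _)]
      exact key t ht s hs h
  refine le_exp_mul_or_exists_le_exp_mul hp hab hcont hac fun b' hb' => ?_
  filter_upwards [hD, (hFint b' hb').ae_hasDerivAt_integral, (hac b' hb').ae_differentiableAt]
    with t hDt hFt hzt ht hC
  have htu : t ∈ uIcc a b' := by rw [uIcc_of_le hb'.1]; exact Ioo_subset_Icc_self ht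
  have htab : t ∈ Ioo a b := ⟨ht.1, ht.2.trans hb'.2⟩
  have hnear : ∀ᶠ s in nhds t, s ∈ Ico a b :=
    mem_of_superset (isOpen_Ioo.mem_nhds htab) Ioo_subset_Ico_self
  have hxt : HasDerivAt x (F t) t :=
    ((hFt htu a left_mem_uIcc).const_add (x a)).congr_of_eventuallyEq
      (hnear.mono fun s hs => (hx s hs).2)
  have hvt : HasDerivAt (fun s => V s (x s)) (deriv z t) t :=
    (hzt htu).hasDerivAt.congr_of_eventuallyEq (hnear.mono fun s hs => (hz s hs).symm)
  obtain ⟨K, S, hS, hlip⟩ := hV (t, x t) ⟨Ioo_subset_Ico_self htab, mem_univ _⟩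
  rw [nhdsWithin_eq_nhds.2 (prod_mem_nhds (show Ico a b ∈ nhds t from hnear) univ_mem)] at hS
  have hder := hasDerivAt_along_tangent hS hlip hxt hvt
  have hlim : Tendsto (fun h : ℝ => (V (t + h) (x t + h • F t) - V t (x t)) / h)
      (nhdsWithin 0 (Ioi 0)) (nhds (deriv z t)) := by
    refine ((hasDerivAt_iff_tendsto_slope.1 hder).mono_left
      (nhdsWithin_mono _ fun h hh => ne_of_gt hh)).congr fun h => ?_
    simp [slope_def_field]
  have hzv := hz t (Ioo_subset_Ico_self htab)
  rw [hzv] at hC ⊢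
  have := hDt htab hC
  rwa [hlim.limsup_eq] at this

theorem inputNorm_nonneg {m : ℕ} (γ : Set ℝ) (u : ℝ → Stt m) (I : Set ℝ) :
    0 ≤ inputNorm γ u I :=
  le_max_of_le_right (Real.sSup_nonneg (by rintro _ ⟨t, _, rfl⟩; exact norm_nonneg _))

theorem norm_le_inputNorm_of_mem {m : ℕ} {γ : Set ℝ} (hγ : IsImpulseSeq γ) (u : ℝ → Stt m)
    {s t r : ℝ} (hr : r ∈ γ) (hrI : r ∈ Ioc s t) : ‖u r‖ ≤ inputNorm γ u (Ioc s t) :=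
  le_max_of_le_right (le_csSup ((hγ.finite_inter_Ioc s t).image _).bddAbove ⟨r, ⟨hr, hrI⟩, rfl⟩)

theorem ae_norm_le_inputNorm {m : ℕ} (γ : Set ℝ) {u : ℝ → Stt m} (hu : IsInput u) {s t : ℝ}
    (hs : 0 ≤ s) : ∀ᵐ r, r ∈ Ioc s t → ‖u r‖ ≤ inputNorm γ u (Ioc s t) := by
  rw [← ae_restrict_iff' measurableSet_Ioc]
  obtain ⟨C, hC⟩ := hu.2 t
  have hbdd : IsBoundedUnder (· ≤ ·) (ae (volume.restrict (Ioc s t))) fun r => ‖u r‖ := by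
    refine ⟨C, ?_⟩
    rw [eventually_map, ae_restrict_iff' measurableSet_Ioc]
    filter_upwards [hC] with r hr hrI
    exact hr ⟨hs.trans hrI.1.le, hrI.2⟩
  filter_upwards [ae_le_essSup hbdd] with r hr
  exact hr.trans (le_max_left _ _)

/-- Growth estimate for the Lyapunov function along a solution on a compact time interval. -/
theorem lyapunov_le_linGain {n m : ℕ} {γ : Set ℝ} (hγ : IsImpulseSeq γ)
    {f g : ℝ → Stt n → Stt m → Stt n} {V Vm : ℝ → Stt n → ℝ} {χ π p : ℝ → ℝ} {d : ℝ}
    (hd : 0 ≤ d) (hp : ∀ a b : ℝ, IntervalIntegrable p volume a b)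
    (hχ : ClassKInf χ) (hπ : ClassKInf π) (hV : InClassV γ V Vm)
    (hflow : ∀ (t : ℝ) (ξ : Stt n) (μ : Stt m), 0 ≤ t → t ∉ γ → χ ‖μ‖ ≤ V t ξ →
      DiniAlong f V t ξ μ ≤ -(p t * V t ξ))
    (hjump : ∀ (t : ℝ) (ξ : Stt n) (μ : Stt m), t ∈ γ → χ ‖μ‖ ≤ Vm t ξ →
      V t (ξ + g t ξ μ) ≤ d * Vm t ξ)
    (hjump' : ∀ (t : ℝ) (ξ : Stt n) (μ : Stt m), t ∈ γ → Vm t ξ ≤ χ ‖μ‖ →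
      V t (ξ + g t ξ μ) ≤ π ‖μ‖)
    {t0 tf : ℝ} {x0 : Stt n} {u : ℝ → Stt m} {T : EReal} {x : ℝ → Stt n}
    (ht0 : 0 ≤ t0) (hu : IsInput u) (hx : IsSolution γ f g t0 x0 u T x) (h0f : t0 ≤ tf)
    (hfT : (tf : EReal) < T) :
    V tf (x tf) ≤ linGain γ p d t0 tf * V t0 x0 ∨
      ∃ s ∈ Icc t0 tf, V tf (x tf) ≤ linGain γ p d s tf *
        (π (inputNorm γ u (Ioc t0 tf)) + (1 + d) * χ (inputNorm γ u (Ioc t0 tf))) := by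
  set U := inputNorm γ u (Ioc t0 tf) with hUdef
  have hU : 0 ≤ U := inputNorm_nonneg _ _ _
  have hχU := hχ.nonneg hU
  have hπU := hπ.nonneg hU
  have hdχ : 0 ≤ d * χ U := mul_nonneg hd hχU
  have hT : ∀ t : ℝ, t ≤ tf → (t : EReal) < T := fun t ht =>
    (EReal.coe_le_coe_iff.2 ht).trans_lt hfT
  have hdini : ∀ a b : ℝ, t0 ≤ a → b ≤ tf → Ioo a b ∩ γ = ∅ →
      ∀ᵐ t, t ∈ Ioo a b → χ U < V t (x t) →
        limsup (fun h : ℝ => (V (t + h) (x t + h • f t (x t) (u t)) - V t (x t)) / h)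
          (nhdsWithin 0 (Ioi 0)) ≤ -(p t * V t (x t)) := by
    intro a b ha hb hnj
    filter_upwards [ae_norm_le_inputNorm γ hu (t := tf) ht0] with t hut ht hC
    have ht0t := ha.trans_lt ht.1
    refine hflow t (x t) (u t) (ht0.trans ht0t.le) (fun htγ => ?_)
      ((hχ.mono (norm_nonneg _) (hut ⟨ht0t, ht.2.le.trans hb⟩)).trans hC.le)
    exact eq_empty_iff_forall_notMem.1 hnj t ⟨ht, htγ⟩
  have hsol : ∀ a b : ℝ, t0 ≤ a → b ≤ tf → Ioc a b ∩ γ = ∅ → a ≤ b →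
      IntegrableOn (fun s => f s (x s) (u s)) (Icc a b) ∧
        x b = x a + ∫ s in a..b, f s (x s) (u s) := fun a b ha hb hnj hab =>
    hx.flow a b ha hab (hT b hb) hnj
  have hcontx : ∀ a b : ℝ, t0 ≤ a → b ≤ tf → Ioc a b ∩ γ = ∅ → a ≤ b →
      ContinuousOn x (Icc a b) := by
    intro a b ha hb hnj hab
    have h1 := intervalIntegral.continuousOn_primitive_interval' (a := a)
      ((intervalIntegrable_iff_integrableOn_Icc_of_le hab).2 (hsol a b ha hb hnj hab).1)
      left_mem_uIcc
    rw [uIcc_of_le hab] at h1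
    exact (continuousOn_const.add h1).congr fun s hs =>
      (hsol a s ha (hs.2.trans hb) (subset_empty_iff.1
        ((inter_subset_inter_left _ (Ioc_subset_Ioc_right hs.2)).trans hnj.subset)) hs.1).2
  have hcontV : ∀ a b b' : ℝ, t0 ≤ a → b ≤ tf → Ioc a b ∩ γ = ∅ → a ≤ b → b < b' →
      Ioo a b' ∩ γ = ∅ → ContinuousOn (fun t => V t (x t)) (Icc a b) := by
    intro a b b' ha hb hnj hab hbb' hgap
    have hVloc : LocallyLipschitzOn (Ico a b' ×ˢ (univ : Set (Stt n)))
      (fun q : ℝ × Stt n => V q.1 q.2) := fun q hq => hV.1 a b' (ht0.trans ha) hgap q hq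
    exact hVloc.continuousOn.comp (continuousOn_id.prodMk (hcontx a b ha hb hnj hab))
      fun s hs => ⟨⟨hs.1, hs.2.trans_lt hbb'⟩, mem_univ _⟩
  have hres := le_linGain_mul_or_exists_le_linGain_mul hγ hp (C := χ U)
    (R := π U + (1 + d) * χ U) (t0 := t0) (tf := tf) hd (by linarith) (by linarith)
    (v := fun t => V t (x t)) ?_ ?_ tf h0f le_rfl
  · simpa only [hx.init] using hres
  · intro a b ha hab hb hnj
    obtain ⟨b', hbb', hgap'⟩ := hγ.exists_gap_right b
    have hgap : Ioo a b' ∩ γ = ∅ := by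
      refine eq_empty_of_forall_notMem fun r hr => ?_
      rcases le_or_gt r b with h | h
      · exact eq_empty_iff_forall_notMem.1 hnj r ⟨⟨hr.1.1, h⟩, hr.2⟩
      · exact eq_empty_iff_forall_notMem.1 hgap' r ⟨⟨h, hr.1.2⟩, hr.2⟩
    have hnj' : Ioo a b ∩ γ = ∅ := subset_empty_iff.1
      ((inter_subset_inter_left _ Ioo_subset_Ioc_self).trans hnj.subset)
    refine lyapunov_flow_alternative (V := V) (x := x) (F := fun s => f s (x s) (u s)) hp hab
      (hV.1 a b (ht0.trans ha) hnj') (fun t ht => ?_) (fun _ _ => rfl)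
      (hcontV a b b' ha hb hnj hab hbb' hgap) (hdini a b ha hb hnj')
    exact hsol a t ha (ht.2.le.trans hb) (subset_empty_iff.1
      ((inter_subset_inter_left _ (Ioc_subset_Ioc_right ht.2.le)).trans hnj.subset)) ht.1
  · intro a b ha hab hb hbγ hgap
    obtain ⟨L, hL, hxb⟩ := hx.jump b hbγ (ha.trans_lt hab) (hT b hb)
    have hub : ‖u b‖ ≤ U := norm_le_inputNorm_of_mem hγ u hbγ ⟨ha.trans_lt hab, hb⟩
    rcases le_total (Vm b L) (χ ‖u b‖) with hle | hge
    · left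
      rw [hxb]
      exact (hjump' b L (u b) hbγ hle).trans
        ((hπ.mono (norm_nonneg _) hub).trans (by linarith))
    · right
      refine ⟨Vm b L, ?_, ?_⟩
      · rw [hxb]
        exact hjump b L (u b) hbγ hge
      have hnj : ∀ t ∈ Ico a b, Ioc a t ∩ γ = ∅ := fun t ht => subset_empty_iff.1
        ((inter_subset_inter_left _ (show Ioc a t ⊆ Ioo a b from
          fun r hr => ⟨hr.1, hr.2.trans_lt ht.2⟩)).trans hgap.subset)
      have hleft : Tendsto (fun t => V t (x t)) (nhdsWithin b (Iio b)) (nhds (Vm b L)) := by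
        refine (hV.2 b hbγ L).comp (f := fun t => (t, x t)) (tendsto_nhdsWithin_iff.2 ⟨?_, ?_⟩)
        · exact (tendsto_nhdsWithin_of_tendsto_nhds tendsto_id).prodMk_nhds hL
        · exact eventually_nhdsWithin_of_forall fun t ht => ⟨ht, mem_univ _⟩
      have halt := lyapunov_flow_alternative (V := V) (x := x) (C := χ U)
        (F := fun s => f s (x s) (u s)) (z := Function.update (fun t => V t (x t)) b (Vm b L))
        hp hab.le (hV.1 a b (ht0.trans ha) hgap)
        (fun t ht => hsol a t ha (ht.2.le.trans hb) (hnj t ht) ht.1)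
        (fun t ht => Function.update_of_ne ht.2.ne _ _) ?_ (hdini a b ha hb hgap)
      · rwa [Function.update_self, Function.update_of_ne hab.ne] at halt
      · intro t ht
        rcases ht.2.eq_or_lt with rfl | htb
        · rw [continuousWithinAt_update_same]
          exact hleft.mono_left (nhdsWithin_mono _ fun r hr => lt_of_le_of_ne hr.1.2 hr.2)
        · obtain ⟨b', htb', hb'b⟩ := exists_between htb
          have h1 := hcontV a b' b ha (hb'b.le.trans hb) (hnj b' ⟨ht.1.trans htb'.le, hb'b⟩)
            (ht.1.trans htb'.le) hb'b hgap t ⟨ht.1, htb'.le⟩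
          rw [continuousWithinAt_update_of_ne htb.ne]
          refine h1.mono_of_mem_nhdsWithin ?_
          filter_upwards [self_mem_nhdsWithin, mem_nhdsWithin_of_mem_nhds (Iic_mem_nhds htb')]
            with r hr hrb
          exact ⟨hr.1, hrb⟩

/-- Theorem 3(a): weak `(h⁰,h)`-ISS under the jump-rate condition (10). -/
theorem stmt4 {n m : ℕ} {Λ : Type*} (γ : Λ → Set ℝ)
    (f g : Λ → ℝ → Stt n → Stt m → Stt n)
    (hγ : ∀ l : Λ, IsImpulseSeq (γ l))
    (h0 h : ℝ → Stt n → ℝ)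
    (hh0 : ∀ (t : ℝ) (ξ : Stt n), 0 ≤ t → 0 ≤ h0 t ξ)
    (hh : ∀ (t : ℝ) (ξ : Stt n), 0 ≤ t → 0 ≤ h t ξ)
    (V Vm : Λ → ℝ → Stt n → ℝ) (φ1 φ2 χ π : ℝ → ℝ)
    (p : Λ → ℝ → ℝ) (d : ℝ) (hd : 0 ≤ d)
    (hpmeas : ∀ l : Λ, Measurable (p l)) (hploc : ∀ l : Λ, LocIntegrable (p l))
    (hA1 : Assumption1 γ f g h0 h V Vm φ1 φ2 χ π
      (fun l t r => p l t * r) (fun _ _ r => d * r))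
    (κ c : ℝ) (hκ : 0 < κ)
    (hlin : ∀ (l : Λ) (w : ℝ → ℝ), IsLinSol (p l) w →
      ∀ t0 t : ℝ, 0 ≤ t0 → t0 ≤ t → |w t| ≤ κ * Real.exp (-(c * (t - t0))) * |w t0|)
    (η μ : ℝ) (hη : 0 < η) (hμ : 0 < μ)
    (hcond : ∀ (l : Λ) (t0 t : ℝ), 0 ≤ t0 → t0 ≤ t →
      (0 < d ∨ nJumps (γ l) t0 t = 0) →
      (nJumps (γ l) t0 t : ℝ) * Real.log d - (c - η) * (t - t0) ≤ μ) :
    WeaklyISS γ f g h0 h := by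
  obtain ⟨hφ1, hφ2, hχ, hπ, hV, -, -, hbd, hflow, hjump, hjump'⟩ := hA1
  obtain ⟨inv, hinv, hinv_left⟩ := hφ1.exists_leftInverse
  have hA : 0 < κ * Real.exp μ := by positivity
  have hρ : ClassKInf fun r => π r + (1 + d) * χ r := hπ.add (hχ.const_mul (by positivity))
  refine ⟨_, _, classKL_comp_exp hinv hφ2 hA hη, hinv.comp (hρ.const_mul hA), ?_⟩
  intro l t0 x0 u T x ht0 hu hx t ht htT
  have hp : ∀ a b : ℝ, IntervalIntegrable (p l) volume a b := fun a b =>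
    IntegrableOn.intervalIntegrable (hploc l (min a b) (max a b))
  set U := inputNorm (γ l) u (Ioc t0 t)
  have hU : 0 ≤ U := inputNorm_nonneg _ _ _
  have hht := hh t (x t) (ht0.trans ht)
  have hV0 : 0 ≤ V l t0 x0 := (hφ1.nonneg (hh t0 x0 ht0)).trans (hbd l t0 x0 ht0).1
  have hφ20 := hφ2.nonneg (hh0 t0 x0 ht0)
  have hgain : ∀ s, 0 ≤ s → s ≤ t → linGain (γ l) (p l) d s t ≤
      κ * Real.exp μ * Real.exp (-(η * (t - s))) := fun s hs hst =>
    linGain_le hp hd hκ (hlin l) (hcond l) hs hst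
  have hβ0 : 0 ≤ κ * Real.exp μ * Real.exp (-(η * (t - t0))) * φ2 (h0 t0 x0) := by positivity
  have hρ0 : 0 ≤ κ * Real.exp μ * (π U + (1 + d) * χ U) := mul_nonneg hA.le (hρ.nonneg hU)
  rw [← hinv_left _ hht]
  rcases lyapunov_le_linGain (hγ l) hd hp hχ hπ (hV l) (hflow l) (hjump l) (hjump' l) ht0 hu hx.1
    ht htT with hle | ⟨s, hs, hle⟩
  · refine le_add_of_le_of_nonneg (hinv.mono (hφ1.nonneg hht) ?_) (hinv.nonneg hρ0)
    refine (hbd l t (x t) (ht0.trans ht)).1.trans (hle.trans ?_)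
    exact mul_le_mul (hgain t0 ht0 ht) (hbd l t0 x0 ht0).2 hV0 (by positivity)
  · refine le_add_of_nonneg_of_le (hinv.nonneg hβ0) (hinv.mono (hφ1.nonneg hht) ?_)
    refine (hbd l t (x t) (ht0.trans ht)).1.trans (hle.trans ?_)
    refine mul_le_mul_of_nonneg_right ((hgain s (ht0.trans hs.1) hs.2).trans ?_) (hρ.nonneg hU)
    refine mul_le_of_le_one_right hA.le (Real.exp_le_one_iff.2 ?_)
    have := mul_nonneg hη.le (sub_nonneg.2 hs.2)
    linarith

end
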